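/- For every m > 0, Ω > 0 with β = 1 + m/Ω, every integer k ≥ 0 and every r ≥ 0, the successive terms of the detection series satisfy I_{k+1,m}(r) ≤ I_{k,m}(r) · (r / ((k+1)√β)) · √(m + k/2 + 1/2) · e^{r²/β}. -/

import Mathlib

open Real

/-- The Pochhammer symbol `(x)_n = x (x+1) ⋯ (x+n−1)` over the reals. -/
noncomputable def poch (x : ℝ) (n : ℕ) : ℝ := (ascPochhammer ℝ n).eval x

/-- The confluent hypergeometric function of the first kind
`₁F₁(a; b; z) = ∑ₙ ((a)ₙ / (b)ₙ) zⁿ / n!`. -/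
noncomputable def oneF1 (a b z : ℝ) : ℝ :=
  ∑' n : ℕ, poch a n / poch b n * z ^ n / (n.factorial : ℝ)

/-- `I_{k,m}(r) = (Γ(m + k/2) / (2 β^{m+k/2} k!)) r^k ₁F₁(m + k/2; k+1; r²/β)`,
where `β = 1 + m/Ω`. -/
noncomputable def Ikm (m Ω : ℝ) (k : ℕ) (r : ℝ) : ℝ :=
  Real.Gamma (m + (k : ℝ) / 2) /
      (2 * (1 + m / Ω) ^ (m + (k : ℝ) / 2) * (k.factorial : ℝ)) * r ^ k *
    oneF1 (m + (k : ℝ) / 2) ((k : ℝ) + 1) (r ^ 2 / (1 + m / Ω))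

lemma poch_zero (x : ℝ) : poch x 0 = 1 := by simp [poch]

lemma poch_succ (x : ℝ) (n : ℕ) : poch x (n + 1) = poch x n * (x + n) := by
  simp [poch, ascPochhammer_succ_eval]

lemma poch_pos {x : ℝ} (hx : 0 < x) (n : ℕ) : 0 < poch x n := ascPochhammer_pos n x hx

lemma poch_le_poch {x y : ℝ} (hx : 0 < x) (hxy : x ≤ y) (n : ℕ) : poch x n ≤ poch y n := by
  induction n with
  | zero => simp [poch_zero]
  | succ n ih =>
    rw [poch_succ, poch_succ]
    have := poch_pos (hx.trans_le hxy) n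
    gcongr

/-- The partial sums of the binomial series `∑ (x)ⱼ / j!`. -/
lemma sum_poch_div_factorial (x : ℝ) (n : ℕ) :
    ∑ j ∈ Finset.range (n + 1), poch x j / (j.factorial : ℝ) =
      poch (x + 1) n / (n.factorial : ℝ) := by
  have shift : ∀ i : ℕ, poch x (i + 1) = x * poch (x + 1) i := by
    intro i
    induction i with
    | zero => simp [poch_zero, poch_succ]
    | succ i ih => rw [poch_succ, ih, poch_succ]; push_cast; ring
  induction n with
  | zero => simp [poch_zero]
  | succ n ih =>
    rw [Finset.sum_range_succ, ih, shift, poch_succ, Nat.factorial_succ]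
    push_cast
    field_simp
    ring

lemma poch_mul_factorial_le {b : ℝ} (hb : 0 < b) (j i : ℕ) :
    poch b j * (i.factorial : ℝ) ≤ poch (b + 1) (j + i) := by
  induction i with
  | zero => simpa using poch_le_poch hb (by linarith) j
  | succ i ih =>
    rw [← add_assoc, poch_succ, Nat.factorial_succ]
    push_cast
    have := poch_pos (show 0 < b + 1 by linarith) (j + i)
    calc poch b j * (((i : ℝ) + 1) * (i.factorial : ℝ))
        = poch b j * (i.factorial : ℝ) * ((i : ℝ) + 1) := by ring
      _ ≤ poch (b + 1) (j + i) * (b + 1 + ((j : ℝ) + i)) := by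
        refine mul_le_mul ih ?_ (by positivity) this.le
        have : (0 : ℝ) ≤ j := j.cast_nonneg
        linarith

lemma poch_div_poch_le_pow {a b : ℝ} (ha : 0 < a) (hb : 0 < b) (n : ℕ) :
    poch a n / poch b n ≤ (1 + a / b) ^ n := by
  induction n with
  | zero => simp [poch_zero]
  | succ n ih =>
    rw [poch_succ, poch_succ, mul_div_mul_comm, pow_succ]
    have hn : (0 : ℝ) ≤ n := n.cast_nonneg
    gcongr
    rw [div_le_iff₀ (by positivity)]
    have h : (1 + a / b) * (b + n) = b + n + a + a * n / b := by field_simp; ring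
    have : 0 ≤ a * n / b := by positivity
    linarith

lemma oneF1_term_nonneg {a b z : ℝ} (ha : 0 < a) (hb : 0 < b) (hz : 0 ≤ z) (n : ℕ) :
    0 ≤ poch a n / poch b n * z ^ n / (n.factorial : ℝ) := by
  have := poch_pos ha n
  have := poch_pos hb n
  positivity

lemma summable_oneF1 {a b z : ℝ} (ha : 0 < a) (hb : 0 < b) (hz : 0 ≤ z) :
    Summable fun n : ℕ => poch a n / poch b n * z ^ n / (n.factorial : ℝ) := by
  refine (Real.summable_pow_div_factorial ((1 + a / b) * z)).of_nonneg_of_le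
    (oneF1_term_nonneg ha hb hz) fun n => ?_
  rw [mul_pow]
  gcongr
  exact poch_div_poch_le_pow ha hb n

lemma oneF1_nonneg {a b z : ℝ} (ha : 0 < a) (hb : 0 < b) (hz : 0 ≤ z) : 0 ≤ oneF1 a b z :=
  tsum_nonneg (oneF1_term_nonneg ha hb hz)

lemma oneF1_le_oneF1 {a a' b z : ℝ} (ha : 0 < a) (haa' : a ≤ a') (hb : 0 < b) (hz : 0 ≤ z) :
    oneF1 a b z ≤ oneF1 a' b z := by
  refine (summable_oneF1 ha hb hz).tsum_le_tsum (fun n => ?_)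
    (summable_oneF1 (ha.trans_le haa') hb hz)
  have := poch_pos hb n
  have := poch_le_poch ha haa' n
  gcongr

lemma poch_succ_args_div_le_sum {a b : ℝ} (ha : 0 < a) (hb : 0 < b) (n : ℕ) :
    poch (a + 1) n / poch (b + 1) n / (n.factorial : ℝ) ≤
      ∑ j ∈ Finset.range (n + 1),
        poch a j / poch b j / (j.factorial : ℝ) / ((n - j).factorial : ℝ) := by
  rw [div_right_comm, ← sum_poch_div_factorial, Finset.sum_div]
  refine Finset.sum_le_sum fun j hj => ?_
  have hjn : j + (n - j) = n := by have := Finset.mem_range.1 hj; omega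
  have h := poch_mul_factorial_le hb j (n - j)
  rw [hjn] at h
  have := poch_pos ha j
  have := poch_pos hb j
  calc poch a j / (j.factorial : ℝ) / poch (b + 1) n
      ≤ poch a j / (j.factorial : ℝ) / (poch b j * ((n - j).factorial : ℝ)) := by gcongr
    _ = _ := by field_simp

/-- Raising both parameters by one costs at most a factor `exp z`. -/
lemma oneF1_succ_args_le {a b z : ℝ} (ha : 0 < a) (hb : 0 < b) (hz : 0 ≤ z) :
    oneF1 (a + 1) (b + 1) z ≤ oneF1 a b z * Real.exp z := by
  have hF := (summable_oneF1 ha hb hz).norm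
  have hE := (Real.summable_pow_div_factorial z).norm
  rw [Real.exp_eq_exp_ℝ, NormedSpace.exp_eq_tsum_div, oneF1, oneF1,
    tsum_mul_tsum_eq_tsum_sum_range_of_summable_norm hF hE]
  refine (summable_oneF1 (by linarith) (by linarith) hz).tsum_le_tsum (fun n => ?_)
    (summable_norm_sum_mul_range_of_summable_norm hF hE).of_norm
  calc poch (a + 1) n / poch (b + 1) n * z ^ n / (n.factorial : ℝ)
      = poch (a + 1) n / poch (b + 1) n / (n.factorial : ℝ) * z ^ n := by ring
    _ ≤ (∑ j ∈ Finset.range (n + 1),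
        poch a j / poch b j / (j.factorial : ℝ) / ((n - j).factorial : ℝ)) * z ^ n := by
      gcongr
      exact poch_succ_args_div_le_sum ha hb n
    _ = _ := by
      rw [Finset.sum_mul]
      refine Finset.sum_congr rfl fun j hj => ?_
      have hjn : j + (n - j) = n := by have := Finset.mem_range.1 hj; omega
      rw [← pow_mul_pow_sub z (Nat.lt_succ_iff.1 (Finset.mem_range.1 hj))]
      ring

lemma Gamma_add_half_le {a : ℝ} (ha : 0 < a) :
    Real.Gamma (a + 1 / 2) ≤ Real.Gamma a * √a := by
  have h := Real.Gamma_mul_add_mul_le_rpow_Gamma_mul_rpow_Gamma (a := 1 / 2) (b := 1 / 2) ha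
    (show 0 < a + 1 by linarith) (by norm_num) (by norm_num) (by norm_num)
  have hG := Real.Gamma_pos_of_pos ha
  rw [Real.Gamma_add_one ha.ne', ← Real.sqrt_eq_rpow, ← Real.sqrt_eq_rpow, Real.sqrt_mul ha.le,
    mul_left_comm, Real.mul_self_sqrt hG.le] at h
  calc Real.Gamma (a + 1 / 2) = Real.Gamma (1 / 2 * a + 1 / 2 * (a + 1)) := by ring_nf
    _ ≤ _ := h
    _ = _ := mul_comm _ _

/-- For `m > 0`, `Ω > 0` with `β = 1 + m/Ω`, every integer `k ≥ 0` and every `r ≥ 0`,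
`I_{k+1,m}(r) ≤ I_{k,m}(r) · (r / ((k+1)√β)) · √(m + k/2 + 1/2) · e^{r²/β}`. -/
theorem Ikm_succ_ratio_bound (m Ω : ℝ) (hm : 0 < m) (hΩ : 0 < Ω) (k : ℕ) (r : ℝ)
    (hr : 0 ≤ r) :
    Ikm m Ω (k + 1) r ≤
      Ikm m Ω k r * (r / (((k : ℝ) + 1) * Real.sqrt (1 + m / Ω))) *
        Real.sqrt (m + (k : ℝ) / 2 + 1 / 2) * Real.exp (r ^ 2 / (1 + m / Ω)) := by
  have hβ : 0 < 1 + m / Ω := by positivity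
  have ha : 0 < m + (k : ℝ) / 2 := by positivity
  have hb : (0 : ℝ) < (k : ℝ) + 1 := by positivity
  have hcast : m + ((k + 1 : ℕ) : ℝ) / 2 = m + (k : ℝ) / 2 + 1 / 2 := by push_cast; ring
  unfold Ikm
  rw [hcast, Nat.factorial_succ, Nat.cast_mul, Nat.cast_add_one]
  set β := 1 + m / Ω
  set a := m + (k : ℝ) / 2
  have hz : 0 ≤ r ^ 2 / β := by positivity
  have hG : Real.Gamma (a + 1 / 2) ≤ Real.Gamma a * √(a + 1 / 2) :=
    (Gamma_add_half_le ha).trans <| by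
      have := Real.Gamma_pos_of_pos ha
      gcongr
      linarith
  have hF : oneF1 (a + 1 / 2) ((k : ℝ) + 1 + 1) (r ^ 2 / β) ≤
      oneF1 a ((k : ℝ) + 1) (r ^ 2 / β) * Real.exp (r ^ 2 / β) :=
    (oneF1_le_oneF1 (by linarith) (by linarith) (by linarith) hz).trans
      (oneF1_succ_args_le ha hb hz)
  have hF0 : 0 ≤ oneF1 (a + 1 / 2) ((k : ℝ) + 1 + 1) (r ^ 2 / β) :=
    oneF1_nonneg (by linarith) (by linarith) hz
  have hΓ := Real.Gamma_pos_of_pos ha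
  rw [Real.rpow_add hβ, ← Real.sqrt_eq_rpow]
  calc Real.Gamma (a + 1 / 2) / (2 * (β ^ a * √β) * (((k : ℝ) + 1) * (k.factorial : ℝ))) *
        r ^ (k + 1) * oneF1 (a + 1 / 2) ((k : ℝ) + 1 + 1) (r ^ 2 / β)
      ≤ Real.Gamma a * √(a + 1 / 2) /
          (2 * (β ^ a * √β) * (((k : ℝ) + 1) * (k.factorial : ℝ))) * r ^ (k + 1) *
          (oneF1 a ((k : ℝ) + 1) (r ^ 2 / β) * Real.exp (r ^ 2 / β)) := by gcongr
    _ = _ := by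
      have := Real.rpow_pos_of_pos hβ a
      have := Real.sqrt_pos.2 hβ
      field_simp
      ring
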